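/- Let 𝓔 : B(ℋ) → B(ℋ) be an ergodic quantum channel with peripheral spectrum {ω_ℓ = e^{2πiℓ/K} : ℓ = 0, …, K−1}. Then the operators R_ℓ, L_ℓ realizing the rank-one peripheral spectral projections P_ℓ = R_ℓ tr(L_ℓ† ·) can be chosen so that, for every ℓ: (i) L_ℓ† commutes with R_ℓ, i.e. [L_ℓ†, R_ℓ] = 0; and (ii) the unique fixed-point state ρ* ∈ T(ℋ) of 𝓔 (the unique density operator with 𝓔(ρ*) = ρ*) satisfies ρ* = R₀ = L_ℓ† R_ℓ = √(R_ℓ† R_ℓ). -/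

import Mathlib

open Matrix Kronecker
open scoped ComplexOrder
noncomputable section

abbrev MatC (n : ℕ) := Matrix (Fin n) (Fin n) ℂ

/-- The Choi-Jamiołkowski matrix of a linear map on matrices. -/
def choi {n : ℕ} (E : MatC n →ₗ[ℂ] MatC n) : Matrix (Fin n × Fin n) (Fin n × Fin n) ℂ :=
  fun p q => E (Matrix.single p.2 q.2 1) p.1 q.1

/-- A quantum channel: a completely positive (equivalently, with positive semidefinite
Choi matrix) and trace-preserving linear map. -/
def IsQuantumChannel {n : ℕ} (E : MatC n →ₗ[ℂ] MatC n) : Prop :=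
  (choi E).PosSemidef ∧ ∀ A : MatC n, (E A).trace = A.trace

/-- A channel is ergodic when its fixed-point space is one-dimensional. -/
def IsErgodic {n : ℕ} (E : MatC n →ₗ[ℂ] MatC n) : Prop :=
  Module.finrank ℂ (Module.End.eigenspace E 1) = 1


/-- `P` is the spectral projection of `E` associated with the eigenvalue `μ`: the projection
onto the generalized eigenspace of `μ` along the sum of all other generalized eigenspaces. -/
def IsSpectralProjection {n : ℕ} (E P : MatC n →ₗ[ℂ] MatC n) (μ : ℂ) : Prop :=
  P ∘ₗ P = P ∧
  LinearMap.range P = Module.End.maxGenEigenspace E μ ∧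
  LinearMap.ker P = ⨆ ν ∈ {ν : ℂ | ν ≠ μ}, Module.End.maxGenEigenspace E ν

section Helpers

open Filter Topology

theorem psd_exists_mul {m : Type*} [Fintype m] [DecidableEq m] {A : Matrix m m ℂ}
    (hA : A.PosSemidef) : ∃ B : Matrix m m ℂ, A = Bᴴ * B := by
  open scoped MatrixOrder in
  have h := CStarAlgebra.nonneg_iff_eq_star_mul_self.mp (Matrix.nonneg_iff_posSemidef.mpr hA)
  exact h

theorem exists_kraus {n : ℕ} (E : MatC n →ₗ[ℂ] MatC n) (hE : IsQuantumChannel E) :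
    ∃ Kr : (Fin n × Fin n) → MatC n,
      (∀ X, E X = ∑ i, Kr i * X * (Kr i)ᴴ) ∧ ∑ i, (Kr i)ᴴ * Kr i = 1 := by
  obtain ⟨B, hB⟩ := psd_exists_mul hE.1
  let Kr : (Fin n × Fin n) → MatC n := fun i => Matrix.of fun a c => star (B i (a, c))
  have h1 : ∀ X, E X = ∑ i, Kr i * X * (Kr i)ᴴ := by
    intro X
    have hs : ∀ c d, E (Matrix.single c d 1) = ∑ i, Kr i * Matrix.single c d 1 * (Kr i)ᴴ := by
      intro c d
      ext a b
      have := congrFun (congrFun hB (a, c)) (b, d)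
      simp only [choi, Matrix.mul_apply, Matrix.conjTranspose_apply] at this
      rw [this, Matrix.sum_apply]
      refine Finset.sum_congr rfl fun i _ => ?_
      simp [Matrix.mul_apply, Matrix.single_apply, Kr, ite_and]
    let F : MatC n →ₗ[ℂ] MatC n :=
      ∑ i, (LinearMap.mulRight ℂ (Kr i)ᴴ) ∘ₗ (LinearMap.mulLeft ℂ (Kr i))
    have hF : ∀ X, F X = ∑ i, Kr i * X * (Kr i)ᴴ := by
      intro X
      simp [F, LinearMap.sum_apply]
    have : E = F := by
      apply Matrix.ext_linearMap
      intro c d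
      ext1
      simp [hs, hF]
    rw [this, hF]
  refine ⟨Kr, h1, ?_⟩
  rw [Matrix.ext_iff_trace_mul_right]
  intro X
  have h2 := hE.2 X
  rw [h1, Matrix.trace_sum] at h2
  rw [Finset.sum_mul, Matrix.trace_sum, one_mul, ← h2]
  refine Finset.sum_congr rfl fun i _ => ?_
  rw [Matrix.mul_assoc, Matrix.trace_mul_comm]

theorem psd_trace_mul_nonneg {n : ℕ} {A B : MatC n} (hA : A.PosSemidef) (hB : B.PosSemidef) :
    0 ≤ (A * B).trace := by
  obtain ⟨X, rfl⟩ := psd_exists_mul hA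
  have := (hB.mul_mul_conjTranspose_same X).trace_nonneg
  rwa [Matrix.mul_assoc, Matrix.trace_mul_comm]

theorem psd_trace_mul_eq_zero {n : ℕ} {A B : MatC n} (hA : A.PosSemidef) (hB : B.PosSemidef)
    (h : (A * B).trace = 0) : A * B = 0 := by
  obtain ⟨X, rfl⟩ := psd_exists_mul hA
  obtain ⟨Y, hY⟩ := psd_exists_mul hB
  have h0 : X * Yᴴ = 0 := by
    rw [← Matrix.trace_mul_conjTranspose_self_eq_zero_iff, ← h, hY, Matrix.mul_assoc Xᴴ,
      Matrix.trace_mul_comm Xᴴ]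
    simp [Matrix.mul_assoc]
  rw [hY, Matrix.mul_assoc, ← Matrix.mul_assoc X, h0]
  simp

theorem psd_entry_le {n : ℕ} {A : MatC n} (hA : A.PosSemidef) (i j : Fin n) :
    ‖A i j‖ ≤ A.trace.re := by
  obtain ⟨B, rfl⟩ := psd_exists_mul hA
  have ht : (Bᴴ * B).trace.re = ∑ a, ∑ k, ‖B k a‖ ^ 2 := by
    simp only [Matrix.trace, Matrix.diag, Matrix.mul_apply, Matrix.conjTranspose_apply,
      Complex.re_sum]
    refine Finset.sum_congr rfl fun a _ => Finset.sum_congr rfl fun k _ => ?_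
    rw [Complex.sq_norm, Complex.normSq_apply]
    simp
  have hi : ∀ a, ∑ k, ‖B k a‖ ^ 2 ≤ (Bᴴ * B).trace.re := by
    intro a
    rw [ht]
    exact Finset.single_le_sum (f := fun a => ∑ k, ‖B k a‖ ^ 2)
      (fun _ _ => Finset.sum_nonneg fun _ _ => by positivity) (Finset.mem_univ a)
  have h1 : ‖(Bᴴ * B) i j‖ ≤ ∑ k, (‖B k i‖ ^ 2 + ‖B k j‖ ^ 2) / 2 := by
    rw [Matrix.mul_apply]
    refine (norm_sum_le _ _).trans (Finset.sum_le_sum fun k _ => ?_)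
    rw [norm_mul, Matrix.conjTranspose_apply, norm_star]
    nlinarith [sq_nonneg (‖B k i‖ - ‖B k j‖)]
  rw [← Finset.sum_div, Finset.sum_add_distrib] at h1
  linarith [hi i, hi j]

theorem kraus_psd {n : ℕ} {ι : Type*} [Fintype ι] {E : MatC n →ₗ[ℂ] MatC n} {Kr : ι → MatC n}
    (hKr : ∀ X, E X = ∑ i, Kr i * X * (Kr i)ᴴ) {A : MatC n} (hA : A.PosSemidef) :
    (E A).PosSemidef := by
  rw [hKr]
  exact Matrix.posSemidef_sum _ fun i _ => hA.mul_mul_conjTranspose_same _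

theorem pow_psd {n : ℕ} {E : MatC n →ₗ[ℂ] MatC n}
    (hpos : ∀ A : MatC n, A.PosSemidef → (E A).PosSemidef) {A : MatC n}
    (hA : A.PosSemidef) (k : ℕ) : ((E ^ k) A).PosSemidef := by
  induction k with
  | zero => simpa using hA
  | succ k ih => rw [pow_succ']; exact hpos _ ih

theorem pow_trace {n : ℕ} {E : MatC n →ₗ[ℂ] MatC n}
    (htr : ∀ A : MatC n, (E A).trace = A.trace) (A : MatC n) (k : ℕ) :
    ((E ^ k) A).trace = A.trace := by
  induction k with
  | zero => simp
  | succ k ih => rw [pow_succ']; exact (htr _).trans ih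

theorem pow_bounded {n : ℕ} {E : MatC n →ₗ[ℂ] MatC n}
    (hpos : ∀ A : MatC n, A.PosSemidef → (E A).PosSemidef)
    (htr : ∀ A : MatC n, (E A).trace = A.trace) (A : MatC n) :
    ∃ C : ℝ, ∀ k i j, ‖((E ^ k) A) i j‖ ≤ C := by
  have hp : ∀ A : MatC n, A.PosSemidef → ∃ C : ℝ, ∀ k i j, ‖((E ^ k) A) i j‖ ≤ C := by
    intro A hA
    refine ⟨A.trace.re, fun k i j => ?_⟩
    rw [← pow_trace htr A k]
    exact psd_entry_le (pow_psd hpos hA k) i j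
  let S : Submodule ℂ (MatC n) :=
    { carrier := {A | ∃ C : ℝ, ∀ k i j, ‖((E ^ k) A) i j‖ ≤ C}
      add_mem' := by
        rintro a b ⟨C, hC⟩ ⟨D, hD⟩
        refine ⟨C + D, fun k i j => ?_⟩
        rw [map_add, Matrix.add_apply]
        exact (norm_add_le _ _).trans (add_le_add (hC k i j) (hD k i j))
      zero_mem' := ⟨0, fun k i j => by simp⟩
      smul_mem' := by
        rintro c a ⟨C, hC⟩
        refine ⟨‖c‖ * C, fun k i j => ?_⟩
        rw [map_smul, Matrix.smul_apply, smul_eq_mul, norm_mul]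
        exact mul_le_mul_of_nonneg_left (hC k i j) (norm_nonneg _) }
  have hS : ∀ B : MatC n, Bᴴ * B ∈ S := fun B => hp _ (Matrix.posSemidef_conjTranspose_mul_self B)
  have hA : A = (1 / 4 : ℂ) • ((1 + A)ᴴ * (1 + A)) - (1 / 4 : ℂ) • ((1 - A)ᴴ * (1 - A))
      - (Complex.I / 4) • ((1 + Complex.I • A)ᴴ * (1 + Complex.I • A))
      + (Complex.I / 4) • ((1 - Complex.I • A)ᴴ * (1 - Complex.I • A)) := by
    simp only [Matrix.conjTranspose_add, Matrix.conjTranspose_sub, Matrix.conjTranspose_smul,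
      Matrix.conjTranspose_one, add_mul, mul_add, sub_mul, mul_sub, one_mul, mul_one,
      smul_mul_assoc, mul_smul_comm, smul_add, smul_sub, smul_smul]
    have hI : Complex.I * Complex.I = -1 := Complex.I_mul_I
    have hI2 : Complex.I / 4 * Complex.I = -(1 / 4 : ℂ) := by
      linear_combination hI / 4
    have hI3 : star Complex.I = -Complex.I := Complex.conj_I
    simp only [hI3, mul_neg, hI2, neg_smul, neg_neg]
    module
  rw [hA]
  exact S.add_mem (S.sub_mem (S.sub_mem (S.smul_mem _ (hS _)) (S.smul_mem _ (hS _)))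
    (S.smul_mem _ (hS _))) (S.smul_mem _ (hS _))

theorem pow_jordan {n : ℕ} {E : MatC n →ₗ[ℂ] MatC n} {w : ℂ} {X Y : MatC n}
    (hX : E X = w • X + Y) (hY : E Y = w • Y) (k : ℕ) :
    w • (E ^ k) X = w ^ (k + 1) • X + ((k : ℂ) * w ^ k) • Y := by
  induction k with
  | zero => simp
  | succ k ih =>
    rw [pow_succ', Module.End.mul_apply, ← map_smul, ih, map_add, map_smul, map_smul, hX, hY]
    push_cast
    module

theorem bounded_step {n : ℕ} {E : MatC n →ₗ[ℂ] MatC n}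
    (hb : ∀ A : MatC n, ∃ C : ℝ, ∀ k i j, ‖((E ^ k) A) i j‖ ≤ C)
    {w : ℂ} (hw : ‖w‖ = 1) {X Y : MatC n}
    (hX : E X = w • X + Y) (hY : E Y = w • Y) : Y = 0 := by
  obtain ⟨C, hC⟩ := hb X
  ext i j
  by_contra hne
  have hpos : 0 < ‖Y i j‖ := norm_pos_iff.mpr hne
  obtain ⟨k, hk⟩ := exists_nat_gt ((C + ‖X i j‖) / ‖Y i j‖)
  rw [div_lt_iff₀ hpos] at hk
  have h := congrFun (congrFun (pow_jordan hX hY k) i) j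
  simp only [Matrix.smul_apply, Matrix.add_apply, smul_eq_mul] at h
  have h2 : (k : ℂ) * w ^ k * Y i j = w * (E ^ k) X i j - w ^ (k + 1) * X i j := by
    rw [h]; ring
  have h3 := norm_sub_le (w * (E ^ k) X i j) (w ^ (k + 1) * X i j)
  rw [← h2] at h3
  simp only [norm_mul, norm_pow, hw, one_pow, one_mul, mul_one, Complex.norm_natCast] at h3
  linarith [hC k i j]

theorem maxGen_eigen {n : ℕ} {E : MatC n →ₗ[ℂ] MatC n}
    (hb : ∀ A : MatC n, ∃ C : ℝ, ∀ k i j, ‖((E ^ k) A) i j‖ ≤ C)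
    {w : ℂ} (hw : ‖w‖ = 1) {X : MatC n} (hX : X ∈ Module.End.maxGenEigenspace E w) :
    E X = w • X := by
  rw [Module.End.mem_maxGenEigenspace] at hX
  obtain ⟨k, hk⟩ := hX
  have key : ∀ k, ((E - w • (1 : Module.End ℂ (MatC n))) ^ (k + 1)) X = 0 → E X = w • X := by
    intro k
    induction k with
    | zero =>
      intro h
      simpa [sub_eq_zero] using h
    | succ k ih =>
      intro h
      apply ih
      set Z := ((E - w • (1 : Module.End ℂ (MatC n))) ^ k) X with hZ
      rw [pow_succ', Module.End.mul_apply, pow_succ', Module.End.mul_apply, ← hZ] at h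
      rw [pow_succ', Module.End.mul_apply, ← hZ]
      refine bounded_step hb hw (X := Z) ?_ ?_
      · simp
      · have : E ((E - w • (1 : Module.End ℂ (MatC n))) Z)
            - w • ((E - w • (1 : Module.End ℂ (MatC n))) Z) = 0 := h
        exact sub_eq_zero.mp this
  rcases k with _ | k
  · have : X = 0 := by simpa using hk
    simp [this]
  · exact key k hk

/-- Cesàro means. -/
def cesaro {n : ℕ} (E : MatC n →ₗ[ℂ] MatC n) (N : ℕ) (A : MatC n) : MatC n :=
  ((N : ℂ)⁻¹) • ∑ k ∈ Finset.range N, (E ^ k) A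

theorem cesaro_tendsto {n : ℕ} {E : MatC n →ₗ[ℂ] MatC n}
    (hb : ∀ A : MatC n, ∃ C : ℝ, ∀ k i j, ‖((E ^ k) A) i j‖ ≤ C)
    {ρ : MatC n} (hρ : E ρ = ρ) (A B : MatC n) (c : ℂ) (hA : A = c • ρ + (E B - B)) :
    Tendsto (fun N => cesaro E N A) atTop (𝓝 (c • ρ)) := by
  have hk : ∀ k, (E ^ k) ρ = ρ := by
    intro k
    induction k with
    | zero => simp
    | succ k ih => rw [pow_succ', Module.End.mul_apply, ih, hρ]
  have hs : ∀ N, ∑ k ∈ Finset.range N, (E ^ k) A = ((N : ℂ) * c) • ρ + ((E ^ N) B - B) := by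
    intro N
    induction N with
    | zero => simp
    | succ N ih =>
      rw [Finset.sum_range_succ, ih, hA, map_add, map_smul, hk, map_sub, pow_succ,
        Module.End.mul_apply]
      push_cast
      module
  obtain ⟨C, hC⟩ := hb B
  refine tendsto_pi_nhds.mpr fun i => tendsto_pi_nhds.mpr fun j => ?_
  have h0 : Tendsto (fun N : ℕ => (N : ℂ)⁻¹ * (((E ^ N) B) i j - B i j)) atTop (𝓝 0) := by
    refine squeeze_zero_norm (a := fun N : ℕ => (N : ℝ)⁻¹ * (C + ‖B i j‖)) ?_ ?_
    · intro N
      rw [norm_mul, norm_inv, Complex.norm_natCast]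
      refine mul_le_mul_of_nonneg_left ?_ (by positivity)
      exact (norm_sub_le _ _).trans (by linarith [hC N i j])
    · simpa using (tendsto_inv_atTop_nhds_zero_nat (𝕜 := ℝ)).mul_const (C + ‖B i j‖)
  have h1 := h0.const_add ((c • ρ) i j)
  rw [add_zero] at h1
  refine h1.congr' ?_
  filter_upwards [eventually_ge_atTop 1] with N hN
  have hN0 : (N : ℂ) ≠ 0 := by
    exact_mod_cast (by omega : N ≠ 0)
  simp only [cesaro, hs, Matrix.smul_apply, Matrix.add_apply, Matrix.sub_apply, smul_eq_mul]
  field_simp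

theorem psd_of_tendsto {n : ℕ} {f : ℕ → MatC n} {A : MatC n} (hf : Tendsto f atTop (𝓝 A))
    (hp : ∀ N, (f N).PosSemidef) : A.PosSemidef := by
  refine Matrix.PosSemidef.of_dotProduct_mulVec_nonneg ?_ ?_
  · have h1 : Tendsto (fun N => (f N)ᴴ) atTop (𝓝 Aᴴ) :=
      (continuous_id.matrix_conjTranspose.tendsto A).comp hf
    have h2 : (fun N => (f N)ᴴ) = f := funext fun N => (hp N).1
    rw [h2] at h1
    exact tendsto_nhds_unique h1 hf
  · intro x
    have hc : Continuous fun M : MatC n => star x ⬝ᵥ (M *ᵥ x) := by fun_prop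
    exact ge_of_tendsto' ((hc.tendsto A).comp hf) fun N => (hp N).dotProduct_mulVec_nonneg x

theorem cesaro_psd {n : ℕ} {E : MatC n →ₗ[ℂ] MatC n}
    (hpos : ∀ A : MatC n, A.PosSemidef → (E A).PosSemidef) {A : MatC n}
    (hA : A.PosSemidef) (N : ℕ) : (cesaro E N A).PosSemidef := by
  refine (Matrix.posSemidef_sum _ fun k _ => pow_psd hpos hA k).smul ?_
  positivity

/-- The fixed point state, with the ergodic decomposition. -/
theorem exists_fixed {n : ℕ} {E : MatC n →ₗ[ℂ] MatC n}
    (hpos : ∀ A : MatC n, A.PosSemidef → (E A).PosSemidef)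
    (htr : ∀ A : MatC n, (E A).trace = A.trace) (hErg : IsErgodic E) :
    ∃ ρ : MatC n, ρ.PosSemidef ∧ ρ.trace = 1 ∧ E ρ = ρ ∧
      (∀ X, E X = X → X = X.trace • ρ) ∧
      (∀ A, Tendsto (fun N => cesaro E N A) atTop (𝓝 (A.trace • ρ))) := by
  have hb := pow_bounded hpos htr
  obtain ⟨⟨X0, hX0m⟩, hne, hspan⟩ := finrank_eq_one_iff'.mp hErg
  have hX0 : E X0 = X0 := by simpa using Module.End.mem_eigenspace_iff.mp hX0m
  have hspan' : ∀ X, E X = X → ∃ c : ℂ, c • X0 = X := by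
    intro X hX
    obtain ⟨c, hc⟩ := hspan ⟨X, Module.End.mem_eigenspace_iff.mpr (by simpa using hX)⟩
    exact ⟨c, congrArg Subtype.val hc⟩
  have hX0ne : X0 ≠ 0 := fun h => hne (Subtype.ext h)
  -- decomposition
  have hdisj : Disjoint (LinearMap.ker (E - 1)) (LinearMap.range (E - 1)) := by
    rw [Submodule.disjoint_def]
    rintro Y hY ⟨X, rfl⟩
    refine bounded_step hb (w := 1) (by simp) (X := X) ?_ ?_
    · simp
    · have : E ((E - 1) X) - (E - 1) X = 0 := hY
      simpa using sub_eq_zero.mp this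
  have htop : LinearMap.ker (E - 1) ⊔ LinearMap.range (E - 1) = ⊤ := by
    apply Submodule.eq_top_of_disjoint _ _ _ hdisj
    rw [add_comm, LinearMap.finrank_range_add_finrank_ker]
  have hdec : ∀ A, ∃ (c : ℂ) (B : MatC n), A = c • X0 + (E B - B) := by
    intro A
    have : A ∈ LinearMap.ker (E - 1) ⊔ LinearMap.range (E - 1) := by rw [htop]; trivial
    obtain ⟨Y, hY, Z, ⟨B, rfl⟩, rfl⟩ := Submodule.mem_sup.mp this
    have hY' : E Y = Y := sub_eq_zero.mp hY
    obtain ⟨c, rfl⟩ := hspan' Y hY'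
    exact ⟨c, B, rfl⟩
  have htrX : X0.trace ≠ 0 := by
    intro h0
    have hall : ∀ A : MatC n, A.trace = 0 := by
      intro A
      obtain ⟨c, B, rfl⟩ := hdec A
      simp [h0, htr]
    apply hX0ne
    rw [← Matrix.trace_conjTranspose_mul_self_eq_zero_iff]
    exact hall _
  let ρ : MatC n := X0.trace⁻¹ • X0
  have hρtr : ρ.trace = 1 := by simp [ρ, htrX]
  have hρ : E ρ = ρ := by simp [ρ, hX0]
  have hXρ : X0 = X0.trace • ρ := by simp [ρ, smul_smul, htrX]
  have hces : ∀ A, Tendsto (fun N => cesaro E N A) atTop (𝓝 (A.trace • ρ)) := by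
    intro A
    obtain ⟨c, B, hA⟩ := hdec A
    have hc : A.trace = c * X0.trace := by rw [hA]; simp [htr]
    refine cesaro_tendsto hb hρ A B _ ?_
    rw [hc, ← smul_smul, ← hXρ]
    exact hA
  refine ⟨ρ, ?_, hρtr, hρ, ?_, hces⟩
  · have hn : n ≠ 0 := by
      rintro rfl
      exact hX0ne (Subsingleton.elim _ _)
    have h1 := hces ((n : ℂ)⁻¹ • (1 : MatC n))
    have h2 : ((n : ℂ)⁻¹ • (1 : MatC n)).trace = 1 := by
      simp [hn]
    rw [h2, one_smul] at h1
    refine psd_of_tendsto h1 fun N => cesaro_psd hpos (Matrix.PosSemidef.one.smul ?_) N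
    positivity
  · intro X hX
    obtain ⟨c, rfl⟩ := hspan' X hX
    simp [ρ, smul_smul, htrX]

section Main

variable {n : ℕ} {ι : Type*} [Fintype ι]

theorem dual_eq {E : MatC n →ₗ[ℂ] MatC n} {Kr : ι → MatC n}
    (hKr : ∀ X, E X = ∑ i, Kr i * X * (Kr i)ᴴ) (V A : MatC n) :
    (V * E A).trace = ((∑ i, (Kr i)ᴴ * V * Kr i) * A).trace := by
  rw [hKr, Finset.mul_sum, Finset.sum_mul, Matrix.trace_sum, Matrix.trace_sum]
  refine Finset.sum_congr rfl fun i _ => ?_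
  rw [← Matrix.mul_assoc, Matrix.trace_mul_comm]
  simp only [Matrix.mul_assoc]

theorem dual_eigen {E : MatC n →ₗ[ℂ] MatC n} {Kr : ι → MatC n}
    (hKr : ∀ X, E X = ∑ i, Kr i * X * (Kr i)ᴴ) {V : MatC n} {w : ℂ}
    (hV : ∀ A, (V * E A).trace = w * (V * A).trace) :
    ∑ i, (Kr i)ᴴ * V * Kr i = w • V := by
  rw [Matrix.ext_iff_trace_mul_right]
  intro A
  rw [← dual_eq hKr, hV]
  simp

/-- The Kadison–Schwarz identity. -/
theorem ks_identity {Kr : ι → MatC n} (hone : ∑ i, (Kr i)ᴴ * Kr i = 1) {V : MatC n} {w : ℂ}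
    (hw : w * star w = 1) (hV : ∑ i, (Kr i)ᴴ * V * Kr i = w • V) :
    ∑ i, (V * Kr i - w • (Kr i * V))ᴴ * (V * Kr i - w • (Kr i * V))
      = (∑ i, (Kr i)ᴴ * (Vᴴ * V) * Kr i) - Vᴴ * V := by
  have hV' : ∑ i, (Kr i)ᴴ * Vᴴ * Kr i = star w • Vᴴ := by
    have := congrArg Matrix.conjTranspose hV
    rw [Matrix.conjTranspose_sum, Matrix.conjTranspose_smul] at this
    rw [← this]
    exact Finset.sum_congr rfl fun i _ => by simp [Matrix.mul_assoc]
  have e : ∀ i, (V * Kr i - w • (Kr i * V))ᴴ * (V * Kr i - w • (Kr i * V))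
      = (Kr i)ᴴ * (Vᴴ * V) * Kr i - w • ((Kr i)ᴴ * Vᴴ * Kr i * V)
        - star w • (Vᴴ * ((Kr i)ᴴ * V * Kr i)) + Vᴴ * ((Kr i)ᴴ * Kr i) * V := by
    intro i
    simp only [Matrix.conjTranspose_sub, Matrix.conjTranspose_smul, Matrix.conjTranspose_mul,
      sub_mul, mul_sub, smul_mul_assoc, mul_smul_comm, smul_smul, smul_sub, Matrix.mul_assoc, hw,
      one_smul]
    abel
  simp only [e, Finset.sum_add_distrib, Finset.sum_sub_distrib, ← Finset.smul_sum,
    ← Finset.sum_mul, ← Finset.mul_sum, hV, hV', hone]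
  simp only [smul_mul_assoc, mul_smul_comm, smul_smul, hw, mul_comm (star w) w, one_smul, mul_one]
  abel

variable {E : MatC n →ₗ[ℂ] MatC n} {Kr : ι → MatC n} {ρ : MatC n}

/-- intertwining relation on the support of `ρ` -/
theorem intertwine (hKr : ∀ X, E X = ∑ i, Kr i * X * (Kr i)ᴴ)
    (hone : ∑ i, (Kr i)ᴴ * Kr i = 1) (hρ : ρ.PosSemidef) (hfix : E ρ = ρ) {V : MatC n} {w : ℂ}
    (hw : w * star w = 1) (hV : ∑ i, (Kr i)ᴴ * V * Kr i = w • V) (i : ι) :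
    Kr i * V * ρ = star w • (V * Kr i * ρ) := by
  have hks := ks_identity hone hw hV
  set D : ι → MatC n := fun i => V * Kr i - w • (Kr i * V) with hD
  have h0 : ∑ i, ((D i)ᴴ * D i * ρ).trace = 0 := by
    rw [← Matrix.trace_sum, ← Finset.sum_mul, hks, sub_mul, Matrix.trace_sub, ← dual_eq hKr, hfix,
      sub_self]
  have h1 : ((D i)ᴴ * D i * ρ).trace = 0 := by
    refine (Finset.sum_eq_zero_iff_of_nonneg fun j _ => ?_).mp h0 i (Finset.mem_univ i)
    exact psd_trace_mul_nonneg (Matrix.posSemidef_conjTranspose_mul_self _) hρ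
  have h2 := psd_trace_mul_eq_zero (Matrix.posSemidef_conjTranspose_mul_self _) hρ h1
  have h3 : D i * ρ = 0 := by
    rw [← Matrix.conjTranspose_mul_self_mul_eq_zero]
    exact h2
  rw [hD] at h3
  simp only [sub_mul, smul_mul_assoc, sub_eq_zero] at h3
  rw [h3, smul_smul, mul_comm, hw, one_smul]

theorem sandwich_fixed (hKr : ∀ X, E X = ∑ i, Kr i * X * (Kr i)ᴴ)
    (hone : ∑ i, (Kr i)ᴴ * Kr i = 1) (hρ : ρ.PosSemidef) (hfix : E ρ = ρ) {V W : MatC n} {w : ℂ}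
    (hw : w * star w = 1) (hV : ∑ i, (Kr i)ᴴ * V * Kr i = w • V)
    (hW : ∑ i, (Kr i)ᴴ * W * Kr i = w • W) :
    E (W * ρ * Vᴴ) = W * ρ * Vᴴ := by
  have e : ∀ i, Kr i * (W * ρ * Vᴴ) * (Kr i)ᴴ = W * (Kr i * ρ * (Kr i)ᴴ) * Vᴴ := by
    intro i
    have h1 := intertwine hKr hone hρ hfix hw hW i
    have h2 := congrArg Matrix.conjTranspose (intertwine hKr hone hρ hfix hw hV i)
    simp only [Matrix.conjTranspose_mul, Matrix.conjTranspose_smul, star_star, hρ.1.eq] at h2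
    calc Kr i * (W * ρ * Vᴴ) * (Kr i)ᴴ = (Kr i * W * ρ) * (Vᴴ * (Kr i)ᴴ) := by
          simp only [Matrix.mul_assoc]
      _ = star w • (W * Kr i * (ρ * (Vᴴ * (Kr i)ᴴ))) := by
          rw [h1]; simp only [Matrix.mul_assoc, smul_mul_assoc]
      _ = W * (Kr i * ρ * (Kr i)ᴴ) * Vᴴ := by
          rw [h2]
          simp only [Matrix.mul_assoc, mul_smul_comm, smul_smul, mul_comm (star w) w, hw, one_smul]
  rw [hKr, Finset.sum_congr rfl fun i _ => e i, ← Finset.sum_mul, ← Finset.mul_sum, ← hKr, hfix]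

/-- `V†V ≤ tr(V†Vρ)`. -/
theorem gram_le (hKr : ∀ X, E X = ∑ i, Kr i * X * (Kr i)ᴴ)
    (hone : ∑ i, (Kr i)ᴴ * Kr i = 1)
    (hces : ∀ A, Tendsto (fun N => cesaro E N A) atTop (𝓝 (A.trace • ρ))) {V : MatC n} {w : ℂ}
    (hw : w * star w = 1) (hV : ∑ i, (Kr i)ᴴ * V * Kr i = w • V)
    {A : MatC n} (hA : A.PosSemidef) :
    (Vᴴ * V * A).trace ≤ (Vᴴ * V * ρ).trace * A.trace := by
  have hpos : ∀ A : MatC n, A.PosSemidef → (E A).PosSemidef := fun A hA => kraus_psd hKr hA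
  have hstep : ∀ A : MatC n, A.PosSemidef → (Vᴴ * V * A).trace ≤ (Vᴴ * V * E A).trace := by
    intro A hA
    rw [dual_eq hKr, ← sub_nonneg, ← Matrix.trace_sub, ← sub_mul, ← ks_identity hone hw hV]
    exact psd_trace_mul_nonneg
      (Matrix.posSemidef_sum _ fun i _ => Matrix.posSemidef_conjTranspose_mul_self _) hA
  have hk : ∀ k, (Vᴴ * V * A).trace ≤ (Vᴴ * V * (E ^ k) A).trace := by
    intro k
    induction k with
    | zero => simp
    | succ k ih =>
      rw [pow_succ']
      exact ih.trans (hstep _ (pow_psd hpos hA k))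
  have hc : Continuous fun M : MatC n => (Vᴴ * V * M).trace := by fun_prop
  have hlim := (hc.tendsto _).comp (hces A)
  have hlim' : (Vᴴ * V * (A.trace • ρ)).trace = (Vᴴ * V * ρ).trace * A.trace := by
    simp [mul_comm]
  rw [← hlim']
  refine ge_of_tendsto hlim ?_
  filter_upwards [eventually_ge_atTop 1] with N hN
  have hN0 : (N : ℂ) ≠ 0 := by
    exact_mod_cast (by omega : N ≠ 0)
  simp only [Function.comp, cesaro, mul_smul_comm, Matrix.trace_smul, Finset.mul_sum,
    Matrix.trace_sum, smul_eq_mul]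
  rw [show (Vᴴ * V * A).trace = (N : ℂ)⁻¹ * ∑ k ∈ Finset.range N, (Vᴴ * V * A).trace by
    rw [Finset.sum_const, Finset.card_range, nsmul_eq_mul]; field_simp]
  rw [← Finset.mul_sum]
  refine mul_le_mul_of_nonneg_left (Finset.sum_le_sum fun k _ => hk k) ?_
  exact inv_nonneg.mpr (Nat.cast_nonneg N)

theorem gram_psd (hKr : ∀ X, E X = ∑ i, Kr i * X * (Kr i)ᴴ)
    (hone : ∑ i, (Kr i)ᴴ * Kr i = 1) (hρ : ρ.PosSemidef)
    (hces : ∀ A, Tendsto (fun N => cesaro E N A) atTop (𝓝 (A.trace • ρ))) {V : MatC n} {w : ℂ}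
    (hw : w * star w = 1) (hV : ∑ i, (Kr i)ᴴ * V * Kr i = w • V) :
    ((Vᴴ * V * ρ).trace • (1 : MatC n) - Vᴴ * V).PosSemidef := by
  have hc0 : 0 ≤ (Vᴴ * V * ρ).trace :=
    psd_trace_mul_nonneg (Matrix.posSemidef_conjTranspose_mul_self _) hρ
  refine Matrix.PosSemidef.of_dotProduct_mulVec_nonneg ?_ ?_
  · exact (Matrix.PosSemidef.one.smul hc0).1.sub (Matrix.posSemidef_conjTranspose_mul_self V).1
  · intro x
    have h := gram_le hKr hone hces hw hV (Matrix.posSemidef_vecMulVec_self_star x)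
    rw [← sub_nonneg] at h
    convert h using 1
    rw [Matrix.sub_mulVec, dotProduct_sub, Matrix.smul_mulVec, Matrix.one_mulVec,
      Matrix.mul_vecMulVec, Matrix.trace_vecMulVec, Matrix.trace_vecMulVec, dotProduct_smul,
      smul_eq_mul, dotProduct_comm (star x) x, dotProduct_comm (star x) (_ *ᵥ x)]

theorem gram_eq (hKr : ∀ X, E X = ∑ i, Kr i * X * (Kr i)ᴴ)
    (hone : ∑ i, (Kr i)ᴴ * Kr i = 1) (hρ : ρ.PosSemidef) (htr : ρ.trace = 1)
    (hces : ∀ A, Tendsto (fun N => cesaro E N A) atTop (𝓝 (A.trace • ρ))) {V : MatC n} {w : ℂ}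
    (hw : w * star w = 1) (hV : ∑ i, (Kr i)ᴴ * V * Kr i = w • V) :
    Vᴴ * V * ρ = (Vᴴ * V * ρ).trace • ρ := by
  have h := psd_trace_mul_eq_zero (gram_psd hKr hone hρ hces hw hV) hρ (by
    simp [sub_mul, htr])
  rw [sub_mul, sub_eq_zero] at h
  rw [← h]
  simp [htr]

theorem eq_zero_of_mul (hKr : ∀ X, E X = ∑ i, Kr i * X * (Kr i)ᴴ)
    (hone : ∑ i, (Kr i)ᴴ * Kr i = 1) (hρ : ρ.PosSemidef)
    (hces : ∀ A, Tendsto (fun N => cesaro E N A) atTop (𝓝 (A.trace • ρ))) {V : MatC n} {w : ℂ}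
    (hw : w * star w = 1) (hV : ∑ i, (Kr i)ᴴ * V * Kr i = w • V)
    (h0 : (Vᴴ * V * ρ).trace = 0) : V = 0 := by
  have h := (gram_psd hKr hone hρ hces hw hV).trace_nonneg
  rw [h0, zero_smul, zero_sub, Matrix.trace_neg] at h
  have h2 := (Matrix.posSemidef_conjTranspose_mul_self V).trace_nonneg
  rw [← Matrix.trace_conjTranspose_mul_self_eq_zero_iff]
  exact le_antisymm (neg_nonneg.mp h) h2

theorem dual_star {V : MatC n} {w : ℂ} (hV : ∑ i, (Kr i)ᴴ * V * Kr i = w • V) :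
    ∑ i, (Kr i)ᴴ * Vᴴ * Kr i = star w • Vᴴ := by
  have := congrArg Matrix.conjTranspose hV
  rw [Matrix.conjTranspose_sum, Matrix.conjTranspose_smul] at this
  rw [← this]
  exact Finset.sum_congr rfl fun i _ => by simp [Matrix.mul_assoc]

/-- Structure of a normalized left eigenvector. -/
theorem left_structure (hKr : ∀ X, E X = ∑ i, Kr i * X * (Kr i)ᴴ)
    (hone : ∑ i, (Kr i)ᴴ * Kr i = 1) (hρ : ρ.PosSemidef) (htr : ρ.trace = 1) (hfix : E ρ = ρ)
    (huniq : ∀ X, E X = X → X = X.trace • ρ)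
    (hces : ∀ A, Tendsto (fun N => cesaro E N A) atTop (𝓝 (A.trace • ρ))) {V : MatC n} {w : ℂ}
    (hw : w * star w = 1) (hV : ∑ i, (Kr i)ᴴ * V * Kr i = w • V)
    (hnorm : (Vᴴ * V * ρ).trace = 1) :
    Vᴴ * V * ρ = ρ ∧ V * Vᴴ * ρ = ρ ∧ V * ρ = ρ * V ∧ E (Vᴴ * ρ) = w • (Vᴴ * ρ) := by
  have hw' : star w * star (star w) = 1 := by rw [star_star, mul_comm]; exact hw
  have hV' := dual_star hV
  have h1 : Vᴴ * V * ρ = ρ := by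
    rw [gram_eq hKr hone hρ htr hces hw hV, hnorm, one_smul]
  have h1' : ρ * (Vᴴ * V) = ρ := by
    have := congrArg Matrix.conjTranspose h1
    simpa [Matrix.mul_assoc, hρ.1.eq] using this
  have h2 : V * ρ * Vᴴ = ρ := by
    rw [huniq _ (sandwich_fixed hKr hone hρ hfix hw hV hV), Matrix.trace_mul_comm,
      ← Matrix.mul_assoc, hnorm, one_smul]
  have hcomm : V * ρ = ρ * V := by
    calc V * ρ = V * (ρ * (Vᴴ * V)) := by rw [h1']
      _ = V * ρ * Vᴴ * V := by simp only [Matrix.mul_assoc]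
      _ = ρ * V := by rw [h2]
  have h3 : V * Vᴴ * ρ = (V * Vᴴ * ρ).trace • ρ := by
    have := gram_eq hKr hone hρ htr hces hw' hV'
    simpa using this
  have hcomm' : Vᴴ * ρ = ρ * Vᴴ := by
    have := congrArg Matrix.conjTranspose hcomm
    simp only [Matrix.conjTranspose_mul, hρ.1.eq] at this
    exact this.symm
  have h4 : V * Vᴴ * ρ = ρ := by
    rw [Matrix.mul_assoc, hcomm', ← Matrix.mul_assoc, h2]
  refine ⟨h1, h4, hcomm, ?_⟩
  rw [hKr, Finset.sum_congr rfl (g := fun i => w • (Vᴴ * (Kr i * ρ * (Kr i)ᴴ)))]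
  · rw [← Finset.smul_sum, ← Finset.mul_sum, ← hKr, hfix]
  · intro i _
    have := intertwine hKr hone hρ hfix hw' hV' i
    rw [star_star] at this
    rw [← Matrix.mul_assoc, this]
    simp only [Matrix.mul_assoc, smul_mul_assoc]

/-- The left eigenspace is one-dimensional. -/
theorem left_unique (hKr : ∀ X, E X = ∑ i, Kr i * X * (Kr i)ᴴ)
    (hone : ∑ i, (Kr i)ᴴ * Kr i = 1) (hρ : ρ.PosSemidef) (htr : ρ.trace = 1) (hfix : E ρ = ρ)
    (huniq : ∀ X, E X = X → X = X.trace • ρ)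
    (hces : ∀ A, Tendsto (fun N => cesaro E N A) atTop (𝓝 (A.trace • ρ))) {V W : MatC n} {w : ℂ}
    (hw : w * star w = 1) (hV : ∑ i, (Kr i)ᴴ * V * Kr i = w • V)
    (hW : ∑ i, (Kr i)ᴴ * W * Kr i = w • W)
    (hnorm : (Vᴴ * V * ρ).trace = 1) : ∃ t : ℂ, W = t • V := by
  obtain ⟨h1, h2, hcomm, -⟩ := left_structure hKr hone hρ htr hfix huniq hces hw hV hnorm
  have h1' : ρ * (Vᴴ * V) = ρ := by
    have := congrArg Matrix.conjTranspose h1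
    simpa [Matrix.mul_assoc, hρ.1.eq] using this
  have hf := huniq _ (sandwich_fixed hKr hone hρ hfix hw hV hW)
  set t := (W * ρ * Vᴴ).trace
  have hWρ : W * ρ = t • (V * ρ) := by
    calc W * ρ = W * (ρ * (Vᴴ * V)) := by rw [h1']
      _ = W * ρ * Vᴴ * V := by simp only [Matrix.mul_assoc]
      _ = t • (V * ρ) := by rw [hf, hcomm, smul_mul_assoc]
  refine ⟨t, sub_eq_zero.mp ?_⟩
  refine eq_zero_of_mul hKr hone hρ hces hw (V := W - t • V) ?_ ?_
  · simp only [mul_sub, sub_mul, Finset.sum_sub_distrib, hW, mul_smul_comm, smul_mul_assoc,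
      ← Finset.smul_sum, hV, smul_sub]
    rw [smul_comm]
  · rw [Matrix.mul_assoc, sub_mul, hWρ, smul_mul_assoc, sub_self]
    simp

theorem exists_trace_functional (f : MatC n →ₗ[ℂ] ℂ) : ∃ V : MatC n, ∀ A, f A = (V * A).trace := by
  refine ⟨Matrix.of fun i j => f (Matrix.single j i 1), fun A => ?_⟩
  let g : MatC n →ₗ[ℂ] ℂ := (Matrix.traceLinearMap (Fin n) ℂ ℂ) ∘ₗ
    (LinearMap.mulLeft ℂ (Matrix.of fun i j => f (Matrix.single j i 1)))
  have : f = g := by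
    apply Matrix.ext_linearMap
    intro c d
    ext1
    simp [g, Matrix.trace_mul_single]
  exact LinearMap.congr_fun this A

/-- Existence of a normalized left eigenvector. -/
theorem exists_left (hKr : ∀ X, E X = ∑ i, Kr i * X * (Kr i)ᴴ)
    (hone : ∑ i, (Kr i)ᴴ * Kr i = 1) (hρ : ρ.PosSemidef)
    (hces : ∀ A, Tendsto (fun N => cesaro E N A) atTop (𝓝 (A.trace • ρ))) {w : ℂ}
    (hw : w * star w = 1) (hev : Module.End.HasEigenvalue E w) :
    ∃ V : MatC n, (∑ i, (Kr i)ᴴ * V * Kr i = w • V) ∧ (Vᴴ * V * ρ).trace = 1 := by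
  have hlt : LinearMap.range (E - w • (1 : Module.End ℂ (MatC n))) < ⊤ := by
    rw [lt_top_iff_ne_top, Ne, LinearMap.range_eq_top, ← LinearMap.injective_iff_surjective]
    intro hinj
    obtain ⟨X, hX⟩ := hev.exists_hasEigenvector
    apply hX.2
    apply hinj
    simp [hX.apply_eq_smul]
  obtain ⟨f, hf0, hf⟩ := Submodule.exists_le_ker_of_lt_top _ hlt
  obtain ⟨V, hVf⟩ := exists_trace_functional f
  have hV : ∑ i, (Kr i)ᴴ * V * Kr i = w • V := by
    refine dual_eigen hKr fun A => ?_
    have : f ((E - w • (1 : Module.End ℂ (MatC n))) A) = 0 := hf ⟨A, rfl⟩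
    rw [LinearMap.sub_apply, map_sub, sub_eq_zero] at this
    simpa [hVf] using this
  have hVne : V ≠ 0 := by
    rintro rfl
    apply hf0
    ext A
    simp [hVf]
  have hc0 : (Vᴴ * V * ρ).trace ≠ 0 := fun h => hVne (eq_zero_of_mul hKr hone hρ hces hw hV h)
  have hcn : 0 ≤ (Vᴴ * V * ρ).trace :=
    psd_trace_mul_nonneg (Matrix.posSemidef_conjTranspose_mul_self _) hρ
  set c := (Vᴴ * V * ρ).trace with hc
  obtain ⟨r, hr0, hrc⟩ : ∃ r : ℝ, 0 < r ∧ c = ((r * r : ℝ) : ℂ) := by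
    obtain ⟨x, hx0, hx⟩ := RCLike.nonneg_iff_exists_ofReal.mp hcn
    have hxpos : 0 < x := lt_of_le_of_ne hx0 (by rintro rfl; apply hc0; rw [← hx]; simp)
    refine ⟨Real.sqrt x, Real.sqrt_pos.mpr hxpos, ?_⟩
    rw [Real.mul_self_sqrt hx0, ← hx]
    rfl
  have hrne : (r : ℂ) ≠ 0 := by exact_mod_cast hr0.ne'
  refine ⟨(r : ℂ)⁻¹ • V, ?_, ?_⟩
  · simp only [mul_smul_comm, smul_mul_assoc, ← Finset.smul_sum, hV]
    rw [smul_comm]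
  · simp only [Matrix.conjTranspose_smul, mul_smul_comm, smul_mul_assoc, Matrix.trace_smul, ← hc,
      hrc, smul_eq_mul]
    simp
    field_simp

theorem spectral_comm {P : MatC n →ₗ[ℂ] MatC n} {w : ℂ} (hP : IsSpectralProjection E P w)
    (A : MatC n) : P (E A) = E (P A) := by
  obtain ⟨hidem, hran, hker⟩ := hP
  have hfixP : ∀ Y ∈ LinearMap.range P, P Y = Y := by
    rintro _ ⟨X, rfl⟩
    exact LinearMap.congr_fun hidem X
  have h1 : P (E (P A)) = E (P A) := by
    apply hfixP
    have : P A ∈ Module.End.maxGenEigenspace E w := hran ▸ ⟨A, rfl⟩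
    rw [hran]
    exact Module.End.mapsTo_maxGenEigenspace_of_comm (Commute.refl E) w this
  have h2 : E (A - P A) ∈ LinearMap.ker P := by
    have h3 : A - P A ∈ LinearMap.ker P := by
      rw [LinearMap.mem_ker, map_sub, hfixP _ ⟨A, rfl⟩, sub_self]
    have h4 : LinearMap.ker P ≤ (LinearMap.ker P).comap E := by
      conv_lhs => rw [hker]
      refine iSup₂_le fun ν hν X hX => ?_
      rw [Submodule.mem_comap, hker]
      exact Submodule.mem_iSup_of_mem ν (Submodule.mem_iSup_of_mem hν
        (Module.End.mapsTo_maxGenEigenspace_of_comm (Commute.refl E) ν hX))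
    exact h4 h3
  rw [LinearMap.mem_ker, map_sub, map_sub, h1, sub_eq_zero] at h2
  exact h2

/-- The spectral projection formula. -/
theorem spectral_formula (hKr : ∀ X, E X = ∑ i, Kr i * X * (Kr i)ᴴ)
    (hone : ∑ i, (Kr i)ᴴ * Kr i = 1) (hρ : ρ.PosSemidef) (htr : ρ.trace = 1) (hfix : E ρ = ρ)
    (huniq : ∀ X, E X = X → X = X.trace • ρ)
    (hces : ∀ A, Tendsto (fun N => cesaro E N A) atTop (𝓝 (A.trace • ρ)))
    (hb : ∀ A : MatC n, ∃ C : ℝ, ∀ k i j, ‖((E ^ k) A) i j‖ ≤ C) {V : MatC n} {w : ℂ}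
    (hw1 : ‖w‖ = 1)
    (hw : w * star w = 1) (hV : ∑ i, (Kr i)ᴴ * V * Kr i = w • V)
    (hnorm : (Vᴴ * V * ρ).trace = 1) {P : MatC n →ₗ[ℂ] MatC n}
    (hP : IsSpectralProjection E P w) (A : MatC n) :
    P A = (V * A).trace • (Vᴴ * ρ) := by
  obtain ⟨h1, h2, hcomm, hR⟩ := left_structure hKr hone hρ htr hfix huniq hces hw hV hnorm
  have hPR : P (Vᴴ * ρ) = Vᴴ * ρ := by
    have : Vᴴ * ρ ∈ LinearMap.range P := by
      rw [hP.2.1, Module.End.mem_maxGenEigenspace]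
      exact ⟨1, by simp [hR]⟩
    obtain ⟨X, hX⟩ := this
    rw [← hX]
    exact LinearMap.congr_fun hP.1 X
  rw [Matrix.ext_iff_trace_mul_left]
  intro Z
  obtain ⟨W, hW⟩ := exists_trace_functional
    ((Matrix.traceLinearMap (Fin n) ℂ ℂ) ∘ₗ (LinearMap.mulLeft ℂ Z) ∘ₗ P)
  have hW' : ∀ A, (Z * P A).trace = (W * A).trace := fun A => by rw [← hW]; simp
  have hWe : ∑ i, (Kr i)ᴴ * W * Kr i = w • W := by
    refine dual_eigen hKr fun A => ?_
    rw [← hW', spectral_comm hP, maxGen_eigen hb hw1 (X := P A) (hP.2.1 ▸ ⟨A, rfl⟩), ← hW']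
    simp
  obtain ⟨t, rfl⟩ := left_unique hKr hone hρ htr hfix huniq hces hw hV hWe hnorm
  have ht : (Z * (Vᴴ * ρ)).trace = t := by
    have := hW' (Vᴴ * ρ)
    rw [hPR, smul_mul_assoc, ← Matrix.mul_assoc V, h2] at this
    rw [this]
    simp [htr]
  rw [hW', mul_smul_comm, Matrix.trace_smul, ht]
  simp [mul_comm]

end Main

end Helpers

/-- **Spectral structure of an ergodic quantum channel (part 3, Corollary).**
For an ergodic quantum channel with peripheral spectrum `{ω_ℓ = e^{2πiℓ/K}}`, the operators
`R_ℓ`, `L_ℓ` realizing the rank-one peripheral spectral projections `P_ℓ = R_ℓ tr(L_ℓ† ·)`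
can be chosen so that `[L_ℓ†, R_ℓ] = 0` for every `ℓ`, and the unique fixed-point state
`ρ*` of `𝓔` satisfies `ρ* = R₀ = L_ℓ† R_ℓ = √(R_ℓ† R_ℓ)` (the latter meaning that `ρ*` is
positive semidefinite with `ρ* ρ* = R_ℓ† R_ℓ`). -/
theorem ergodic_peripheral_projections_fixed_point {n : ℕ} (E : MatC n →ₗ[ℂ] MatC n)
    (hE : IsQuantumChannel E) (hErg : IsErgodic E)
    (K : ℕ) (hK : 1 ≤ K) (ω : Fin K → ℂ)
    (hω : ∀ ℓ : Fin K,
      ω ℓ = Complex.exp (2 * (Real.pi : ℂ) * Complex.I * ((ℓ : ℕ) : ℂ) / ((K : ℕ) : ℂ)))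
    (hspec : {μ : ℂ | Module.End.HasEigenvalue E μ ∧ ‖μ‖ = 1} = Set.range ω)
    (P : Fin K → (MatC n →ₗ[ℂ] MatC n))
    (hP : ∀ ℓ, IsSpectralProjection E (P ℓ) (ω ℓ)) :
    ∃ (R L : Fin K → MatC n) (ρstar : MatC n),
      (∀ ℓ (A : MatC n), P ℓ A = ((L ℓ)ᴴ * A).trace • R ℓ) ∧
      (∀ ℓ, (L ℓ)ᴴ * R ℓ = R ℓ * (L ℓ)ᴴ) ∧
      ρstar.PosSemidef ∧ ρstar.trace = 1 ∧ E ρstar = ρstar ∧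
      (∀ σ : MatC n, σ.PosSemidef → σ.trace = 1 → E σ = σ → σ = ρstar) ∧
      ρstar = R ⟨0, hK⟩ ∧
      (∀ ℓ, ρstar = (L ℓ)ᴴ * R ℓ) ∧
      (∀ ℓ, ρstar * ρstar = (R ℓ)ᴴ * R ℓ) := by
  obtain ⟨Kr, hKr, hone⟩ := exists_kraus E hE
  have hpos : ∀ A : MatC n, A.PosSemidef → (E A).PosSemidef := fun A hA => kraus_psd hKr hA
  have hb := pow_bounded hpos hE.2
  obtain ⟨ρ, hρ, htr, hfix, huniq, hces⟩ := exists_fixed hpos hE.2 hErg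
  have hper : ∀ ℓ, Module.End.HasEigenvalue E (ω ℓ) ∧ ‖ω ℓ‖ = 1 := by
    intro ℓ
    have : ω ℓ ∈ {μ : ℂ | Module.End.HasEigenvalue E μ ∧ ‖μ‖ = 1} := hspec ▸ ⟨ℓ, rfl⟩
    exact this
  have hww : ∀ ℓ, ω ℓ * star (ω ℓ) = 1 := by
    intro ℓ
    have : ω ℓ * star (ω ℓ) = ((‖ω ℓ‖ ^ 2 : ℝ) : ℂ) := by
      rw [← Complex.normSq_eq_norm_sq]
      exact Complex.mul_conj _
    rw [this, (hper ℓ).2]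
    simp
  have hω0 : ω ⟨0, hK⟩ = 1 := by rw [hω]; simp
  have hex : ∀ ℓ, ∃ V : MatC n, (∑ i, (Kr i)ᴴ * V * Kr i = ω ℓ • V) ∧
      (Vᴴ * V * ρ).trace = 1 ∧ (ℓ = ⟨0, hK⟩ → V = 1) := by
    intro ℓ
    by_cases h : ℓ = ⟨0, hK⟩
    · refine ⟨1, ?_, ?_, fun _ => rfl⟩
      · rw [h, hω0]
        simpa using hone
      · simpa using htr
    · obtain ⟨V, h1, h2⟩ := exists_left hKr hone hρ hces (hww ℓ) (hper ℓ).1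
      exact ⟨V, h1, h2, fun h' => absurd h' h⟩
  choose V hV hnorm hV0 using hex
  have hst := fun ℓ =>
    left_structure hKr hone hρ htr hfix huniq hces (hww ℓ) (hV ℓ) (hnorm ℓ)
  have hcomm' : ∀ ℓ, (V ℓ)ᴴ * ρ = ρ * (V ℓ)ᴴ := by
    intro ℓ
    have := congrArg Matrix.conjTranspose (hst ℓ).2.2.1
    simp only [Matrix.conjTranspose_mul, hρ.1.eq] at this
    exact this.symm
  have hVR : ∀ ℓ, V ℓ * ((V ℓ)ᴴ * ρ) = ρ := by
    intro ℓ
    rw [← Matrix.mul_assoc]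
    exact (hst ℓ).2.1
  refine ⟨fun ℓ => (V ℓ)ᴴ * ρ, fun ℓ => (V ℓ)ᴴ, ρ, ?_, ?_, hρ, htr, hfix, ?_, ?_, ?_, ?_⟩
  · intro ℓ A
    rw [Matrix.conjTranspose_conjTranspose]
    exact spectral_formula hKr hone hρ htr hfix huniq hces hb (hper ℓ).2 (hww ℓ) (hV ℓ) (hnorm ℓ)
      (hP ℓ) A
  · intro ℓ
    simp only [Matrix.conjTranspose_conjTranspose]
    rw [hVR, Matrix.mul_assoc, ← (hst ℓ).2.2.1, ← Matrix.mul_assoc, (hst ℓ).1]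
  · intro σ _ h1 h2
    rw [huniq σ h2, h1, one_smul]
  · simp [hV0]
  · intro ℓ
    simp only [Matrix.conjTranspose_conjTranspose]
    exact (hVR ℓ).symm
  · intro ℓ
    simp only [Matrix.conjTranspose_conjTranspose, Matrix.conjTranspose_mul, hρ.1.eq]
    rw [Matrix.mul_assoc, hVR]
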